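/- arXiv:2309.04492 — 4 statements merged into one kernel-verified Lean document; each statement's English description precedes it below -/
import Mathlib

section
/- Let α : ℝ → ℝ be locally Lipschitz, strictly increasing, with α(0) = 0 (an extended class-K function). Let φ : ℝ → ℝ be differentiable on [0, ∞) with φ(0) ≥ 0. If φ'(t) ≥ −α(φ(t)) for all t ≥ 0, then φ(t) ≥ 0 for all t ≥ 0. -/
/-- Comparison lemma for CBFs with a general extended class-K function `α`
(locally Lipschitz, strictly increasing, `α 0 = 0`): if `φ(0) ≥ 0` and
`φ' ≥ −α ∘ φ` on `[0, ∞)`, then `φ(t) ≥ 0` for all `t ≥ 0`. -/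
theorem barrier_comparison_classK (α : ℝ → ℝ)
    (hlip : LocallyLipschitz α) (hmono : StrictMono α) (hα0 : α 0 = 0)
    (φ φ' : ℝ → ℝ)
    (hderiv : ∀ t ∈ Set.Ici (0 : ℝ), HasDerivWithinAt φ (φ' t) (Set.Ici (0 : ℝ)) t)
    (h0 : 0 ≤ φ 0)
    (hineq : ∀ t ∈ Set.Ici (0 : ℝ), -α (φ t) ≤ φ' t) :
    ∀ t ∈ Set.Ici (0 : ℝ), 0 ≤ φ t := by
  intro t ht
  have ht0 : (0 : ℝ) ≤ t := ht
  have key : ∀ ε : ℝ, 0 < ε → -φ t ≤ ε := by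
    intro ε hε
    have hc : ContinuousOn (fun x => -φ x) (Set.Icc 0 t) := fun x hx =>
      ((hderiv x hx.1).continuousWithinAt.mono Set.Icc_subset_Ici_self).neg
    refine image_le_of_deriv_right_lt_deriv_boundary (f := fun x => -φ x)
      (f' := fun x => -φ' x) (B := fun _ => ε) (B' := fun _ => 0) hc ?_ ?_ ?_ ?_
      (Set.right_mem_Icc.2 ht0)
    · intro x hx
      exact ((hderiv x hx.1).mono (Set.Ici_subset_Ici.2 hx.1)).neg
    · show -φ 0 ≤ ε
      linarith
    · intro x
      exact hasDerivAt_const x ε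
    · intro x hx hxe
      have hxe' : -φ x = ε := hxe
      have h1 : α (φ x) < α 0 := hmono (by linarith)
      have h2 := hineq x hx.1
      show -φ' x < 0
      linarith
  have := le_of_forall_pos_le_add (a := -φ t) (b := 0) (fun ε hε => by linarith [key ε hε])
  linarith
end

section
/- Let α : ℝ → ℝ be locally Lipschitz, strictly increasing, with α(0) = 0 (an extended class-K function). Let φ : ℝ → ℝ be differentiable on [0, ∞) with φ(0) > 0. If φ'(t) ≥ −α(φ(t)) for all t ≥ 0, then φ(t) > 0 for all t ≥ 0. -/
/-- Strict comparison lemma for CBFs with a general extended class-K function `α`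
(locally Lipschitz, strictly increasing, `α 0 = 0`): if `φ(0) > 0` and
`φ' ≥ −α ∘ φ` on `[0, ∞)`, then `φ(t) > 0` for all `t ≥ 0`. -/
theorem barrier_comparison_classK_strict (α : ℝ → ℝ)
    (hlip : LocallyLipschitz α) (hmono : StrictMono α) (hα0 : α 0 = 0)
    (φ φ' : ℝ → ℝ)
    (hderiv : ∀ t ∈ Set.Ici (0 : ℝ), HasDerivWithinAt φ (φ' t) (Set.Ici (0 : ℝ)) t)
    (h0 : 0 < φ 0)
    (hineq : ∀ t ∈ Set.Ici (0 : ℝ), -α (φ t) ≤ φ' t) :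
    ∀ t ∈ Set.Ici (0 : ℝ), 0 < φ t := by
  intro t0 ht0
  by_contra hneg
  push Not at hneg
  have hcont : ContinuousOn φ (Set.Ici 0) := fun t ht => (hderiv t ht).continuousWithinAt
  have ivt : ∀ t : ℝ, 0 ≤ t → φ t ≤ 0 → ∃ z ∈ Set.Icc 0 t, φ z = 0 := by
    intro t ht h
    have := intermediate_value_Icc' ht (hcont.mono Set.Icc_subset_Ici_self)
    exact this ⟨h, h0.le⟩
  obtain ⟨z, hz, hz0⟩ := ivt t0 ht0 hneg
  have hcomp : IsCompact (Set.Icc 0 t0 ∩ φ ⁻¹' {0}) :=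
    isCompact_Icc.of_isClosed_subset
      ((hcont.mono Set.Icc_subset_Ici_self).preimage_isClosed_of_isClosed isClosed_Icc
        isClosed_singleton) Set.inter_subset_left
  obtain ⟨T, ⟨⟨hT0, hTt⟩, hφT⟩, hmin⟩ := hcomp.exists_isLeast ⟨z, hz, hz0⟩
  have hφT : φ T = 0 := hφT
  have hpos : ∀ t, 0 ≤ t → t < T → 0 < φ t := by
    intro t ht htT
    by_contra h
    push Not at h
    obtain ⟨y, hy, hy0⟩ := ivt t ht h
    have : T ≤ y := hmin ⟨⟨hy.1, by linarith [hy.2]⟩, hy0⟩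
    linarith [hy.2]
  have hTpos : 0 < T := by
    rcases hT0.lt_or_eq with h | h
    · exact h
    · rw [← h] at hφT; linarith
  obtain ⟨K, U, hU, hK⟩ := hlip 0
  have hc := hcont T hT0
  rw [ContinuousWithinAt, hφT] at hc
  have hev := hc hU
  rw [Filter.mem_map, Metric.mem_nhdsWithin_iff] at hev
  obtain ⟨δ, hδ, hball⟩ := hev
  obtain ⟨s, hs1, hsT⟩ := exists_between (max_lt hTpos (sub_lt_self T hδ))
  have hs0 : 0 < s := (le_max_left _ _).trans_lt hs1
  have hsδ : T - δ < s := (le_max_right _ _).trans_lt hs1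
  have hd : ∀ t ∈ Set.Ici (0:ℝ), HasDerivWithinAt (fun t => φ t * Real.exp (K * t))
      (φ' t * Real.exp (K * t) + φ t * (Real.exp (K * t) * (K * 1))) (Set.Ici 0) t := by
    intro t ht
    exact (hderiv t ht).mul (((hasDerivAt_id t).const_mul (K:ℝ)).exp.hasDerivWithinAt)
  have hsub : Set.Icc s T ⊆ Set.Ici 0 := fun t ht => hs0.le.trans ht.1
  have hm : MonotoneOn (fun t => φ t * Real.exp (K * t)) (Set.Icc s T) := by
    refine monotoneOn_of_hasDerivWithinAt_nonneg (convex_Icc s T)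
      (fun t ht => ((hd t (hsub ht)).continuousWithinAt).mono hsub)
      (fun t ht => (hd t (hsub (interior_subset ht))).mono (interior_subset.trans hsub)) ?_
    intro t ht
    rw [interior_Icc] at ht
    have ht0 : 0 ≤ t := hs0.le.trans ht.1.le
    have hp := hpos t ht0 ht.2
    have hmem : φ t ∈ U := hball ⟨by
      rw [Metric.mem_ball, Real.dist_eq, abs_lt]
      constructor <;> linarith [ht.1, ht.2], ht0⟩
    have hl := hK.dist_le_mul _ hmem _ (mem_of_mem_nhds hU)
    rw [Real.dist_eq, Real.dist_eq, hα0, sub_zero, sub_zero, abs_of_pos hp] at hl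
    have h1 := hineq t ht0
    have h2 := le_abs_self (α (φ t))
    have h3 : 0 ≤ φ' t + K * φ t := by linarith
    have h4 := mul_nonneg h3 (Real.exp_pos (K * t)).le
    nlinarith [h4]
  have := hm ⟨le_rfl, hsT.le⟩ ⟨hsT.le, le_rfl⟩ hsT.le
  simp only [hφT, zero_mul] at this
  have := mul_pos (hpos s hs0.le hsT) (Real.exp_pos (K * s))
  linarith
end

section
/- (High Order CBF forward invariance, Theorem 1 of the paper, stated along a trajectory with linear class-K functions.) Let m ≥ 1, let c₁, …, c_m > 0, and let φ₀ : ℝ → ℝ be m times differentiable on [0, ∞). Define recursively φᵢ(t) = φᵢ₋₁'(t) + cᵢ·φᵢ₋₁(t) for i = 1, …, m. If φ_m(t) ≥ 0 for all t ≥ 0 and φᵢ(0) ≥ 0 for every i = 0, …, m−1, then φᵢ(t) ≥ 0 for every i = 0, …, m−1 and every t ≥ 0; in particular φ₀(t) ≥ 0 for all t ≥ 0. -/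
theorem hocbf_step (f f' : ℝ → ℝ) (c : ℝ)
    (hd : ∀ t ∈ Set.Ici (0 : ℝ), HasDerivWithinAt f (f' t) (Set.Ici (0 : ℝ)) t)
    (hn : ∀ t ∈ Set.Ici (0 : ℝ), 0 ≤ f' t + c * f t) (h0 : 0 ≤ f 0) :
    ∀ t ∈ Set.Ici (0 : ℝ), 0 ≤ f t := by
  intro t ht
  have hg : ∀ s ∈ Set.Ici (0 : ℝ), HasDerivWithinAt (fun s => Real.exp (c * s) * f s)
      (Real.exp (c * s) * (f' s + c * f s)) (Set.Ici (0 : ℝ)) s := by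
    intro s hs
    have h1 : HasDerivAt (fun s : ℝ => Real.exp (c * s)) (Real.exp (c * s) * (c * 1)) s :=
      ((hasDerivAt_id s).const_mul c).exp
    have h2 := h1.hasDerivWithinAt (s := Set.Ici (0 : ℝ)).mul (hd s hs)
    exact h2.congr_deriv (by ring)
  have hm : MonotoneOn (fun s => Real.exp (c * s) * f s) (Set.Ici (0 : ℝ)) := by
    refine monotoneOn_of_hasDerivWithinAt_nonneg (convex_Ici 0)
      (fun s hs => (hg s hs).continuousWithinAt)
      (fun s hs => (hg s (interior_subset hs)).mono interior_subset)
      (fun s hs => mul_nonneg (Real.exp_pos _).le (hn s (interior_subset hs)))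
  have h := hm (Set.mem_Ici.2 le_rfl) ht ht
  simp only [mul_zero, Real.exp_zero, one_mul] at h
  exact nonneg_of_mul_nonneg_right (h0.trans h) (Real.exp_pos _)

/-- High Order CBF forward invariance along a trajectory, with linear class-K
functions `αᵢ r = cᵢ * r`. The functions `φ i` for `i = 0, …, m` are related by
`φ i = (φ (i-1))' + cᵢ · φ (i-1)` on `[0, ∞)` (with `φ' i` the derivative of
`φ i` within `[0, ∞)`). If `φ m ≥ 0` on `[0, ∞)` and `φ i (0) ≥ 0` for all
`i < m`, then `φ i (t) ≥ 0` for all `i < m` and all `t ≥ 0`; in particular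
`φ 0`, the barrier value, stays nonnegative. -/
theorem hocbf_forward_invariance_linear (m : ℕ) (hm : 1 ≤ m)
    (c : ℕ → ℝ) (hc : ∀ i, 1 ≤ i → i ≤ m → 0 < c i)
    (φ φ' : ℕ → ℝ → ℝ)
    (hderiv : ∀ i < m, ∀ t ∈ Set.Ici (0 : ℝ),
      HasDerivWithinAt (φ i) (φ' i t) (Set.Ici (0 : ℝ)) t)
    (hrec : ∀ i, 1 ≤ i → i ≤ m → ∀ t ∈ Set.Ici (0 : ℝ),
      φ i t = φ' (i - 1) t + c i * φ (i - 1) t)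
    (htop : ∀ t ∈ Set.Ici (0 : ℝ), 0 ≤ φ m t)
    (h0 : ∀ i < m, 0 ≤ φ i 0) :
    ∀ i < m, ∀ t ∈ Set.Ici (0 : ℝ), 0 ≤ φ i t := by
  have key : ∀ k ≤ m, ∀ t ∈ Set.Ici (0 : ℝ), 0 ≤ φ (m - k) t := by
    intro k
    induction k with
    | zero => intro _; simpa using htop
    | succ k ih =>
      intro hk
      have e : m - k = (m - (k + 1)) + 1 := by omega
      have ih' := ih (by omega)
      refine hocbf_step _ (φ' (m - (k + 1))) (c (m - k)) (hderiv _ (by omega)) ?_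
        (h0 _ (by omega))
      intro t ht
      have h := hrec (m - k) (by omega) (by omega) t ht
      have e2 : m - k - 1 = m - (k + 1) := by omega
      rw [e2] at h
      rw [← h]
      exact ih' t ht
  intro i hi
  have h := key (m - i) (by omega)
  rwa [show m - (m - i) = i by omega] at h
end

section
/- (Core of the paper's main theorem: safety of the continuous optimization learning model for non-affine control systems, stated along a trajectory.) Let m ≥ 1, let c₁, …, c_m > 0, let ϑ > 0, and let α : ℝ → ℝ be locally Lipschitz, strictly increasing, with α(0) = 0 (an extended class-K function). Let φ₀ : ℝ → ℝ be m+1 times differentiable on [0, ∞). Define recursively φᵢ(t) = φᵢ₋₁'(t) + cᵢ·φᵢ₋₁(t) for i = 1, …, m, and φ_{m+1}(t) = φ_m'(t) + ϑ·α(φ_m(t)). If φ_{m+1}(t) ≥ 0 for all t ≥ 0 and φᵢ(0) ≥ 0 for every i = 0, …, m, then φ₀(t) ≥ 0 for all t ≥ 0. -/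
theorem nonneg_of_deriv_barrier (f f' : ℝ → ℝ)
    (hd : ∀ t ∈ Set.Ici (0 : ℝ), HasDerivWithinAt f (f' t) (Set.Ici (0 : ℝ)) t)
    (h0 : 0 ≤ f 0) (h : ∀ t ∈ Set.Ici (0 : ℝ), f t < 0 → 0 ≤ f' t) :
    ∀ t ∈ Set.Ici (0 : ℝ), 0 ≤ f t := by
  intro T hT
  have hT' : (0 : ℝ) ≤ T := hT
  have key : ∀ ε : ℝ, 0 < ε → - f T ≤ ε * (1 + T) := by
    intro ε hε
    have hBd : ∀ x : ℝ, HasDerivAt (fun x : ℝ => ε * (1 + x)) ε x := by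
      intro x
      simpa using ((hasDerivAt_id x).const_add 1).const_mul ε
    refine image_le_of_deriv_right_lt_deriv_boundary' (f := fun x => - f x)
      (f' := fun x => - f' x) (B := fun x => ε * (1 + x)) (B' := fun _ => ε) (a := 0) (b := T)
      ?_ ?_ ?_ ?_ ?_ ?_ ⟨hT', le_refl T⟩
    · intro x hx
      exact ((hd x hx.1).continuousWithinAt.mono (fun y hy => hy.1)).neg
    · intro x hx
      exact ((hd x hx.1).mono (Set.Ici_subset_Ici.2 hx.1)).neg
    · show - f 0 ≤ ε * (1 + 0)
      nlinarith
    · exact fun x _ => (hBd x).continuousAt.continuousWithinAt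
    · exact fun x _ => (hBd x).hasDerivWithinAt
    · intro x hx hfx
      have hx0 : 0 ≤ x := hx.1
      have hp : 0 < ε * (1 + x) := by positivity
      have hfx' : - f x = ε * (1 + x) := hfx
      have := h x hx.1 (by linarith)
      show - f' x < ε
      linarith
  by_contra hneg
  push Not at hneg
  have hpos : 0 < 1 + T := by linarith
  have h1 := key (- f T / (2 * (1 + T))) (div_pos (by linarith) (by linarith))
  have h2 : - f T / (2 * (1 + T)) * (1 + T) = - f T / 2 := by
    field_simp
  linarith

/-- Core of the paper's main theorem: safety of the continuous optimization
learning model for non-affine control systems, stated along a trajectory.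
The functions `φ i` for `i = 0, …, m` are related by
`φ i = (φ (i-1))' + cᵢ · φ (i-1)` (linear class-K functions), and the extra top
layer is `φ (m+1) = (φ m)' + ϑ · α (φ m)` with trainable parameter `ϑ > 0` and
extended class-K function `α` (locally Lipschitz, strictly increasing, `α 0 = 0`).
If the BarrierNet enforces `φ (m+1) ≥ 0` on `[0, ∞)` and `φ i (0) ≥ 0` for all
`i ≤ m`, then the system is safe: `φ 0 (t) ≥ 0` for all `t ≥ 0`. -/
theorem safe_neural_control_nonaffine (m : ℕ) (hm : 1 ≤ m)
    (c : ℕ → ℝ) (hc : ∀ i, 1 ≤ i → i ≤ m → 0 < c i)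
    (ϑ : ℝ) (hϑ : 0 < ϑ)
    (α : ℝ → ℝ) (hlip : LocallyLipschitz α) (hmono : StrictMono α) (hα0 : α 0 = 0)
    (φ φ' : ℕ → ℝ → ℝ)
    (hderiv : ∀ i ≤ m, ∀ t ∈ Set.Ici (0 : ℝ),
      HasDerivWithinAt (φ i) (φ' i t) (Set.Ici (0 : ℝ)) t)
    (hrec : ∀ i, 1 ≤ i → i ≤ m → ∀ t ∈ Set.Ici (0 : ℝ),
      φ i t = φ' (i - 1) t + c i * φ (i - 1) t)
    (htoprec : ∀ t ∈ Set.Ici (0 : ℝ), φ (m + 1) t = φ' m t + ϑ * α (φ m t))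
    (htop : ∀ t ∈ Set.Ici (0 : ℝ), 0 ≤ φ (m + 1) t)
    (h0 : ∀ i ≤ m, 0 ≤ φ i 0) :
    ∀ t ∈ Set.Ici (0 : ℝ), 0 ≤ φ 0 t := by
  have main : ∀ k ≤ m, ∀ t ∈ Set.Ici (0 : ℝ), 0 ≤ φ (m - k) t := by
    intro k
    induction k with
    | zero =>
      intro _
      refine nonneg_of_deriv_barrier (φ m) (φ' m) (hderiv m le_rfl) (h0 m le_rfl) ?_
      intro t ht hlt
      have h1 := htop t ht
      rw [htoprec t ht] at h1
      have h2 : α (φ m t) < 0 := hα0 ▸ hmono hlt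
      have h3 := mul_neg_of_pos_of_neg hϑ h2
      linarith
    | succ k ih =>
      intro hk
      refine nonneg_of_deriv_barrier _ (φ' (m - (k + 1))) (hderiv _ (by omega))
        (h0 _ (by omega)) ?_
      intro t ht hlt
      have h1 := ih (by omega) t ht
      rw [hrec (m - k) (by omega) (by omega) t ht] at h1
      have e : m - k - 1 = m - (k + 1) := by omega
      rw [e] at h1
      have h3 := mul_neg_of_pos_of_neg (hc (m - k) (by omega) (by omega)) hlt
      linarith
  simpa using main m le_rfl
end
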